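/- For any integers n, N > 1 with N < n there exists a constant c(n, N) > 0 such that for every prime l > c(n, N) and any two rings of integers 𝒪 and 𝒪' of finite extensions of ℚ_l, there is no abstract (not assumed continuous) group homomorphism φ: GL_n(𝒪') → GL_N(𝒪) whose image is non-abelian. -/

import Mathlib

open Matrix

theorem choose_ge_self (n k : ℕ) (hk : 0 < k) (hkn : k < n) : n ≤ n.choose k := by
  induction n generalizing k with
  | zero => omega
  | succ n ih =>
    obtain ⟨k, rfl⟩ : ∃ m, k = m + 1 := ⟨k - 1, by omega⟩
    rw [Nat.choose_succ_succ]
    rcases Nat.eq_zero_or_pos k with rfl | h0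
    · simp
    · rcases Nat.lt_or_ge (k + 1) n with h1 | h1
      · have := ih k h0 (by omega)
        have := ih (k + 1) (by omega) h1
        simp only [Nat.succ_eq_add_one]
        omega
      · have h2 : n = k + 1 := by omega
        subst h2
        simp

/-- Commuting involutions permuted by the symmetric group on a small space are all equal. -/
theorem involutions_eq {K V : Type*} [Field K] [AddCommGroup V] [Module K V]
    [FiniteDimensional K V] (h2 : (2 : K) ≠ 0) (n : ℕ) (hV : Module.finrank K V < n)
    (A : Fin n → Module.End K V) (P : Equiv.Perm (Fin n) → Module.End K V)
    (hA : ∀ i v, A i (A i v) = v) (hc : ∀ i j v, A i (A j v) = A j (A i v))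
    (hP : ∀ σ v, P σ v = 0 → v = 0) (hPA : ∀ σ i v, P σ (A i v) = A (σ i) (P σ v))
    (a b : Fin n) : A a = A b := by
  classical
  by_contra hne
  have hK : (1 : K) ≠ -1 := by
    intro h
    apply h2
    linear_combination h
  obtain ⟨v, hv⟩ : ∃ v, A a v ≠ A b v := by
    by_contra! h
    exact hne (LinearMap.ext h)
  have key : ∀ T : Finset (Fin n), ∃ w : V, w ≠ 0 ∧ A a w = - A b w ∧
      ∀ i ∈ T, A i w = w ∨ A i w = -w := by
    intro T
    induction T using Finset.induction_on with
    | empty =>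
      refine ⟨A a v - A b v, sub_ne_zero.mpr hv, ?_, by simp⟩
      rw [map_sub, map_sub, hA, hA, hc b a]
      abel
    | insert i T hi ih =>
      obtain ⟨w, hw, hab, hT⟩ := ih
      by_cases h : w + A i w = 0
      · refine ⟨w, hw, hab, ?_⟩
        intro j hj
        rcases Finset.mem_insert.mp hj with rfl | hj
        · right; exact (neg_eq_of_add_eq_zero_right h).symm
        · exact hT j hj
      · refine ⟨w + A i w, h, ?_, ?_⟩
        · rw [map_add, map_add, hc a i, hc b i, hab, map_neg]
          abel
        · intro j hj
          rcases Finset.mem_insert.mp hj with rfl | hj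
          · left; rw [map_add, hA, add_comm]
          · rw [map_add, hc j i]
            rcases hT j hj with h | h
            · left; rw [h]
            · right; rw [h, map_neg]; abel
  obtain ⟨w, hw, hab, hT⟩ := key Finset.univ
  have hw2 : w ≠ -w := by
    intro h
    apply hw
    have : (2 : K) • w = 0 := by
      rw [two_smul]; nth_rewrite 1 [h]; simp
    exact (smul_eq_zero.mp this).resolve_left h2
  let S : Finset (Fin n) := Finset.univ.filter (fun i => A i w = -w)
  have hS : ∀ i, A i w = (if i ∈ S then (-1 : K) else 1) • w := by
    intro i
    by_cases hi : A i w = -w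
    · simp [S, hi]
    · have := (hT i (Finset.mem_univ _)).resolve_right hi
      simp [S, this, hw2]
  have hcard0 : 0 < S.card := by
    rw [Finset.card_pos]
    rcases hT a (Finset.mem_univ _) with h | h
    · refine ⟨b, ?_⟩
      simp only [S, Finset.mem_filter, Finset.mem_univ, true_and]
      rw [h] at hab
      rw [eq_neg_iff_add_eq_zero, add_comm, ← eq_neg_iff_add_eq_zero]
      exact hab
    · exact ⟨a, by simp [S, h]⟩
  have hcardn : S.card < n := by
    have : S ≠ Finset.univ := by
      intro h
      have h1 : A a w = -w := by
        have : a ∈ S := h ▸ Finset.mem_univ _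
        simpa [S] using this
      have h2 : A b w = -w := by
        have : b ∈ S := h ▸ Finset.mem_univ _
        simpa [S] using this
      rw [h1, h2, neg_neg] at hab
      exact hw2 hab.symm
    have := Finset.card_lt_card (Finset.ssubset_univ_iff.mpr this)
    simpa using this
  -- nonzero joint eigenvector for each subset of the same cardinality
  have hex : ∀ T : {T : Finset (Fin n) // T.card = S.card}, ∃ u : V, u ≠ 0 ∧
      ∀ i, A i u = (if i ∈ T.1 then (-1 : K) else 1) • u := by
    rintro ⟨T, hTc⟩
    let e : {x // x ∈ S} ≃ {x // x ∈ T} := Finset.equivOfCardEq hTc.symm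
    let σ : Equiv.Perm (Fin n) := e.extendSubtype
    refine ⟨P σ w, fun h => hw (hP σ w h), ?_⟩
    intro i
    obtain ⟨j, rfl⟩ := σ.surjective i
    rw [← hPA, hS, map_smul]
    have : σ j ∈ T ↔ j ∈ S := by
      constructor
      · intro h
        by_contra hj
        exact e.extendSubtype_not_mem j hj h
      · intro h
        exact e.extendSubtype_mem j h
    simp [this]
  choose u hu0 hu using hex
  have hind : iSupIndep fun χ : Fin n → K ↦ ⨅ i, (A i).maxGenEigenspace (χ i) := by
    apply Module.End.independent_iInf_maxGenEigenspace_of_forall_mapsTo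
    intro i j μ
    apply Module.End.mapsTo_maxGenEigenspace_of_comm
    ext v
    exact hc _ _ _
  let χ : {T : Finset (Fin n) // T.card = S.card} → Fin n → K :=
    fun T i => if i ∈ T.1 then (-1 : K) else 1
  have hχ : Function.Injective χ := by
    rintro T T' h
    ext i
    have := congrFun h i
    simp only [χ] at this
    by_cases h1 : i ∈ T.1 <;> by_cases h2 : i ∈ T'.1
    · exact iff_of_true h1 h2
    · rw [if_pos h1, if_neg h2] at this
      exact absurd this.symm hK
    · rw [if_neg h1, if_pos h2] at this
      exact absurd this hK
    · exact iff_of_false h1 h2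
  have hli : LinearIndependent K u := by
    refine (hind.comp hχ).linearIndependent _ ?_ hu0
    intro T
    simp only [Function.comp, Submodule.mem_iInf]
    intro i
    rw [Module.End.mem_maxGenEigenspace]
    refine ⟨1, ?_⟩
    rw [pow_one, LinearMap.sub_apply, hu T i, LinearMap.smul_apply, Module.End.one_apply, sub_self]
  have h3 := hli.fintype_card_le_finrank
  rw [Fintype.card_finset_len, Fintype.card_fin] at h3
  have := choose_ge_self n S.card hcard0 hcardn
  omega

theorem isLocal_integralClosure (l : ℕ) [Fact (Nat.Prime l)] (K : Type) [Field K]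
    [Algebra ℚ_[l] K] [FiniteDimensional ℚ_[l] K] [Algebra ℤ_[l] K]
    [IsScalarTower ℤ_[l] ℚ_[l] K] : IsLocalRing (integralClosure ℤ_[l] K) := by
  have hle : ∀ x : K, spectralNorm ℚ_[l] K x ≤ 1 → IsIntegral ℤ_[l] x := by
    intro x hx
    have hxI : IsIntegral ℚ_[l] x := Algebra.IsIntegral.isIntegral x
    have hm := minpoly.monic hxI
    have hc := (spectralValue_le_one_iff hm).mp hx
    have hl : minpoly ℚ_[l] x ∈ Polynomial.lifts (algebraMap ℤ_[l] ℚ_[l]) := by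
      rw [Polynomial.lifts_iff_coeff_lifts]
      intro n
      exact ⟨⟨_, hc n⟩, rfl⟩
    obtain ⟨q, hq, -, hqm⟩ := Polynomial.lifts_and_natDegree_eq_and_monic hl hm
    refine ⟨q, hqm, ?_⟩
    rw [IsScalarTower.algebraMap_eq ℤ_[l] ℚ_[l] K, ← Polynomial.eval₂_map, hq]
    exact minpoly.aeval _ _
  have hge : ∀ x : K, IsIntegral ℤ_[l] x → spectralNorm ℚ_[l] K x ≤ 1 := by
    intro x hx
    have hxI : IsIntegral ℚ_[l] x := Algebra.IsIntegral.isIntegral x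
    refine (spectralValue_le_one_iff (minpoly.monic hxI)).mpr ?_
    intro n
    rw [minpoly.isIntegrallyClosed_eq_field_fractions' ℚ_[l] hx, Polynomial.coeff_map]
    exact ((minpoly ℤ_[l] x).coeff n).2
  have hunit : ∀ x : integralClosure ℤ_[l] K, spectralNorm ℚ_[l] K (x : K) = 1 → IsUnit x := by
    intro x hx
    have hx0 : (x : K) ≠ 0 := by
      intro h
      rw [h, spectralNorm_zero] at hx
      exact zero_ne_one hx
    have hinv : spectralNorm ℚ_[l] K (x : K)⁻¹ ≤ 1 := by
      have := map_mul (spectralMulAlgNorm ℚ_[l] K) (x : K) (x : K)⁻¹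
      rw [mul_inv_cancel₀ hx0, map_one, spectralMulAlgNorm_def, spectralMulAlgNorm_def, hx,
        one_mul] at this
      exact this.symm.le
    refine IsUnit.of_mul_eq_one ⟨(x : K)⁻¹, hle _ hinv⟩ ?_
    ext
    simp [hx0]
  refine IsLocalRing.of_isUnit_or_isUnit_one_sub_self fun a => ?_
  by_contra! h
  have h1 : spectralNorm ℚ_[l] K (a : K) < 1 :=
    lt_of_le_of_ne (hge _ a.2) fun hh => h.1 (hunit _ hh)
  have h2 : spectralNorm ℚ_[l] K ((1 - a : integralClosure ℤ_[l] K) : K) < 1 :=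
    lt_of_le_of_ne (hge _ (1 - a).2) fun hh => h.2 (hunit _ hh)
  have h3 := isNonarchimedean_spectralNorm (K := ℚ_[l]) (L := K) (a : K)
    ((1 - a : integralClosure ℤ_[l] K) : K)
  have h4 : (a : K) + ((1 - a : integralClosure ℤ_[l] K) : K) = 1 := by simp
  rw [h4, spectralNorm_one] at h3
  exact absurd h3 (not_le.mpr (max_lt h1 h2))

section GLaux
variable {n : ℕ} {R : Type*} [CommRing R]

def tv (i j : Fin n) (h : i ≠ j) (c : R) : GL (Fin n) R :=
  ⟨transvection i j c, transvection i j (-c),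
    by rw [transvection_mul_transvection_same _ _ h]; simp,
    by rw [transvection_mul_transvection_same _ _ h]; simp⟩

def dg (u : Fin n → Rˣ) : GL (Fin n) R :=
  ⟨diagonal (fun i => (u i : R)), diagonal (fun i => ((u i)⁻¹ : Rˣ)),
    by simp [diagonal_mul_diagonal], by simp [diagonal_mul_diagonal]⟩

theorem dg_comm (u v : Fin n → Rˣ) : dg u * dg v = dg v * dg u := by
  ext i j
  simp only [dg, Units.val_mul, diagonal_mul_diagonal, mul_comm]

def pm : Equiv.Perm (Fin n) →* GL (Fin n) R :=
  (permMatrixHom (n := Fin n) (R := R)).toHomUnits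

theorem pm_dg (σ : Equiv.Perm (Fin n)) (u : Fin n → Rˣ) :
    pm σ * dg u = dg (u ∘ ⇑σ⁻¹) * pm σ := by
  ext i j
  simp only [pm, dg, Units.val_mul, MonoidHom.coe_toHomUnits, permMatrixHom_apply,
    mul_diagonal, diagonal_mul, PEquiv.toMatrix_apply, Equiv.toPEquiv_apply, Function.comp]
  by_cases h : σ⁻¹ i = j
  · subst h; simp
  · have h' : ¬ (Equiv.symm σ) i = j := h
    simp [h']

theorem dg_tv (u : Fin n → Rˣ) (i j : Fin n) (h : i ≠ j) (c d : R)
    (hcd : (u i : R) * c = d * u j) : dg u * tv i j h c = tv i j h d * dg u := by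
  ext a b
  simp only [dg, tv, Units.val_mul, mul_diagonal, diagonal_mul, transvection, Matrix.add_apply,
    Matrix.one_apply, Matrix.single_apply]
  by_cases h1 : i = a ∧ j = b
  · obtain ⟨rfl, rfl⟩ := h1
    simp [h, hcd]
  · simp only [h1, if_false, add_zero]
    by_cases h2 : a = b
    · simp [h2]
    · simp [h2]

theorem tv_add (i j : Fin n) (h : i ≠ j) (c d : R) :
    tv i j h c * tv i j h d = tv i j h (c + d) := by
  ext a b
  simp [tv, transvection_mul_transvection_same _ _ h]

/-- The subgroup generated by transvections and diagonal matrices. -/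
def genSub (n : ℕ) (R : Type*) [CommRing R] : Subgroup (GL (Fin n) R) :=
  Subgroup.closure ({g | ∃ i j h c, g = tv i j h c} ∪ {g | ∃ u, g = dg u})

theorem tv_mem (i j : Fin n) (h : i ≠ j) (c : R) : tv i j h c ∈ genSub n R :=
  Subgroup.subset_closure (Or.inl ⟨i, j, h, c, rfl⟩)

theorem dg_mem (u : Fin n → Rˣ) : dg u ∈ genSub n R :=
  Subgroup.subset_closure (Or.inr ⟨u, rfl⟩)

theorem tv_mul_apply (i j : Fin n) (h : i ≠ j) (c : R) (g : GL (Fin n) R) (a b : Fin n) :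
    (tv i j h c * g) a b = g a b + if a = i then c * g j b else 0 := by
  rw [Units.val_mul]
  by_cases ha : a = i
  · subst ha
    simp [tv]
  · simp [tv, ha]

theorem dg_mul_apply (u : Fin n → Rˣ) (g : GL (Fin n) R) (a b : Fin n) :
    (dg u * g) a b = u a * g a b := by
  rw [Units.val_mul]
  simp [dg, diagonal_mul]

theorem gauss_step [IsLocalRing R] (s : Finset (Fin n)) (k : Fin n) (hk : k ∉ s)
    (g : GL (Fin n) R) (hg : ∀ j ∈ s, ∀ i, g i j = if i = j then 1 else 0) :
    ∃ c ∈ genSub n R, ∀ j ∈ insert k s, ∀ i, (c * g) i j = if i = j then 1 else 0 := by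
  -- a unit in column k
  obtain ⟨p, hps, hp⟩ : ∃ p, p ∉ s ∧ IsUnit (g p k) := by
    by_contra! hcon
    have hinv : ∀ i, ∀ j ∈ s, (g⁻¹ : GL (Fin n) R) i j = if i = j then 1 else 0 := by
      intro i j hj
      have h1 : ((g⁻¹ * g : GL (Fin n) R) : Matrix _ _ R) i j = (g⁻¹ : GL (Fin n) R) i j := by
        rw [Units.val_mul, Matrix.mul_apply, Finset.sum_eq_single j]
        · rw [hg j hj]; simp
        · intro b _ hb
          rw [hg j hj]; simp [hb]
        · simp
      rw [← h1, inv_mul_cancel, Units.val_one, Matrix.one_apply]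
    have h1 : ((g⁻¹ * g : GL (Fin n) R) : Matrix _ _ R) k k = 1 := by
      rw [inv_mul_cancel]; simp
    rw [Units.val_mul, Matrix.mul_apply] at h1
    have h2 : ∑ j, (g⁻¹ : GL (Fin n) R) k j * g j k ∈ IsLocalRing.maximalIdeal R := by
      refine Ideal.sum_mem _ fun j _ => ?_
      by_cases hj : j ∈ s
      · rw [hinv k j hj, if_neg (by rintro rfl; exact hk hj), zero_mul]
        exact Ideal.zero_mem _
      · exact Ideal.mul_mem_left _ _ (hcon j hj)
    rw [h1] at h2
    exact (Ideal.ne_top_iff_one _).mp (IsLocalRing.maximalIdeal.isMaximal R).ne_top h2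
  -- make the pivot a unit
  obtain ⟨c1, hc1, h1s, h1k⟩ : ∃ c ∈ genSub n R,
      (∀ j ∈ s, ∀ i, (c * g) i j = if i = j then 1 else 0) ∧ IsUnit ((c * g) k k) := by
    by_cases hkk : IsUnit (g k k)
    · exact ⟨1, one_mem _, by simpa using hg, by simpa using hkk⟩
    · have hpk : k ≠ p := by rintro rfl; exact hkk hp
      refine ⟨tv k p hpk 1, tv_mem _ _ _ _, ?_, ?_⟩
      · intro j hj i
        rw [tv_mul_apply, hg j hj, hg j hj p, if_neg (c := p = j) (by rintro rfl; exact hps hj)]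
        simp
      · rw [tv_mul_apply, if_pos rfl, one_mul]
        by_contra hcon
        have := Ideal.sub_mem (IsLocalRing.maximalIdeal R) (a := g k k + g p k) (b := g k k)
          hcon hkk
        rw [add_sub_cancel_left] at this
        exact this hp
  -- make it one
  obtain ⟨c2, hc2, h2s, h2k⟩ : ∃ c ∈ genSub n R,
      (∀ j ∈ s, ∀ i, (c * g) i j = if i = j then 1 else 0) ∧ (c * g) k k = 1 := by
    obtain ⟨u, hu⟩ := h1k
    refine ⟨dg (Function.update 1 k u⁻¹) * c1, mul_mem (dg_mem _) hc1, ?_, ?_⟩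
    · intro j hj i
      rw [mul_assoc, dg_mul_apply, h1s j hj]
      by_cases hi : i = j
      · subst hi
        have : i ≠ k := by rintro rfl; exact hk hj
        simp [this]
      · simp [hi]
    · rw [mul_assoc, dg_mul_apply, ← hu]
      simp
  -- clear
  have hclear : ∀ t : Finset (Fin n), k ∉ t → ∃ c ∈ genSub n R,
      (∀ j ∈ s, ∀ i, (c * g) i j = if i = j then 1 else 0) ∧ (c * g) k k = 1 ∧
      ∀ i ∈ t, (c * g) i k = 0 := by
    intro t
    induction t using Finset.induction_on with
    | empty => exact fun _ => ⟨c2, hc2, h2s, h2k, by simp⟩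
    | insert a t ha ih =>
      intro hkt
      rw [Finset.mem_insert, not_or] at hkt
      obtain ⟨c, hc, hs, hkk, ht⟩ := ih hkt.2
      refine ⟨tv a k (Ne.symm hkt.1) (-(c * g) a k) * c, mul_mem (tv_mem _ _ _ _) hc, ?_, ?_, ?_⟩
      · intro j hj i
        rw [mul_assoc, tv_mul_apply, hs j hj, hs j hj k,
          if_neg (c := k = j) (by rintro rfl; exact hk hj)]
        simp
      · rw [mul_assoc, tv_mul_apply, hkk, if_neg hkt.1, add_zero]
      · intro i hi
        rw [mul_assoc, tv_mul_apply, hkk]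
        rcases Finset.mem_insert.mp hi with rfl | hit
        · simp
        · rw [ht i hit, if_neg (by rintro rfl; exact ha hit), add_zero]
  obtain ⟨c, hc, hs, hkk, ht⟩ := hclear (Finset.univ.erase k) (by simp)
  refine ⟨c, hc, ?_⟩
  intro j hj i
  rcases Finset.mem_insert.mp hj with rfl | hj
  · by_cases hi : i = j
    · subst hi; simp [hkk]
    · rw [if_neg hi]; exact ht i (by simp [hi])
  · exact hs j hj i

theorem genSub_eq_top [IsLocalRing R] (g : GL (Fin n) R) : g ∈ genSub n R := by
  have : ∀ s : Finset (Fin n), ∃ c ∈ genSub n R, ∀ j ∈ s, ∀ i,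
      (c * g) i j = if i = j then 1 else 0 := by
    intro s
    induction s using Finset.induction_on with
    | empty => exact ⟨1, one_mem _, by simp⟩
    | insert k s hk ih =>
      obtain ⟨c, hc, h⟩ := ih
      obtain ⟨d, hd, h'⟩ := gauss_step s k hk _ h
      exact ⟨d * c, mul_mem hd hc, by simpa only [mul_assoc] using h'⟩
  obtain ⟨c, hc, h⟩ := this Finset.univ
  have h1 : c * g = 1 := by
    ext i j
    rw [h j (Finset.mem_univ _), Units.val_one, Matrix.one_apply]
  rw [eq_inv_of_mul_eq_one_right h1]
  exact inv_mem hc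

/-- the sign matrices -/
def sg (i : Fin n) : GL (Fin n) R := dg (Function.update 1 i (-1))

theorem sg_sq (i : Fin n) : (sg i * sg i : GL (Fin n) R) = 1 := by
  ext a b
  rw [sg, dg_mul_apply, Units.val_one, Matrix.one_apply]
  by_cases h : a = i
  · subst h; simp [dg, diagonal_apply]
  · simp [dg, diagonal_apply, h]

theorem pm_sg (σ : Equiv.Perm (Fin n)) (i : Fin n) :
    (pm σ * sg i : GL (Fin n) R) = sg (σ i) * pm σ := by
  rw [sg, pm_dg, sg]
  congr 2
  ext a
  by_cases h : a = σ i
  · subst h; simp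
  · have : σ⁻¹ a ≠ i := by rintro rfl; simp at h
    rw [Function.comp_apply, Function.update_of_ne this, Function.update_of_ne h]
    rfl

variable {K V : Type*} [Field K] [AddCommGroup V] [Module K V]

theorem rep_tv (hn : 2 < n) (h2R : IsUnit (2 : R)) (ψ : GL (Fin n) R →* Module.End K V)
    (hsg : ∀ i j, ψ (sg i) = ψ (sg j)) (i j : Fin n) (h : i ≠ j) (c : R) :
    ψ (tv i j h c) = 1 := by
  obtain ⟨k, hki, hkj⟩ : ∃ k : Fin n, k ≠ i ∧ k ≠ j := by
    by_contra! hcon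
    have : (Finset.univ : Finset (Fin n)) ⊆ {i, j} := by
      intro k _
      by_cases hk : k = i
      · simp [hk]
      · simp [hcon k hk]
    have h1 := Finset.card_le_card this
    have h3 := Finset.card_le_two (a := i) (b := j)
    simp at h1
    omega
  have hneg : ∀ d : R, ψ (tv i j h d) = ψ (tv i j h (-d)) := by
    intro d
    have h1 : sg i * tv i j h d = tv i j h (-d) * sg i := by
      apply dg_tv
      simp [Ne.symm h]
    have h3 : sg k * tv i j h d = tv i j h d * sg k := by
      apply dg_tv
      simp [hki.symm, hkj.symm]
    have e1 := congrArg ψ h1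
    have e3 := congrArg ψ h3
    rw [map_mul, map_mul] at e1 e3
    rw [hsg k i, e1] at e3
    have e4 : ψ (sg i) * ψ (sg i) = 1 := by rw [← map_mul, sg_sq, map_one]
    have e5 := congrArg (· * ψ (sg i)) e3
    simp only [mul_assoc, e4, mul_one] at e5
    exact e5.symm
  obtain ⟨t, ht⟩ := h2R
  have hc : c = (↑t⁻¹ * c) + (↑t⁻¹ * c) := by
    rw [← two_mul, ← ht, Units.mul_inv_cancel_left]
  rw [hc, ← tv_add, map_mul]
  nth_rewrite 2 [hneg]
  rw [← map_mul, tv_add, add_neg_cancel]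
  have : tv i j h (0 : R) = 1 := by ext a b; simp [tv]
  rw [this, map_one]

theorem rep_comm [IsLocalRing R] (hn : 2 < n) (h2R : IsUnit (2 : R))
    (ψ : GL (Fin n) R →* Module.End K V) (hsg : ∀ i j, ψ (sg i) = ψ (sg j))
    (g h : GL (Fin n) R) : ψ g * ψ h = ψ h * ψ g := by
  have hgen : ∀ x ∈ ({g | ∃ i j h c, g = tv i j h c} ∪ {g | ∃ u, g = dg u} :
      Set (GL (Fin n) R)), ∀ y ∈ ({g | ∃ i j h c, g = tv i j h c} ∪ {g | ∃ u, g = dg u} :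
      Set (GL (Fin n) R)), ψ x * ψ y = ψ y * ψ x := by
    rintro x (⟨i, j, hij, c, rfl⟩ | ⟨u, rfl⟩) y (⟨i', j', hij', c', rfl⟩ | ⟨u', rfl⟩)
    all_goals try simp only [rep_tv hn h2R ψ hsg, one_mul, mul_one]
    rw [← map_mul, dg_comm, map_mul]
  have hg : g ∈ genSub n R := genSub_eq_top g
  have hh : h ∈ genSub n R := genSub_eq_top h
  have hinv : ∀ (x : GL (Fin n) R) (T : Module.End K V), ψ x * T = T * ψ x →
      ψ x⁻¹ * T = T * ψ x⁻¹ := by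
    intro x T hx
    have e1 : ψ x * ψ x⁻¹ = 1 := by rw [← map_mul, mul_inv_cancel, map_one]
    have e2 : ψ x⁻¹ * ψ x = 1 := by rw [← map_mul, inv_mul_cancel, map_one]
    calc ψ x⁻¹ * T = ψ x⁻¹ * (T * ψ x) * ψ x⁻¹ := by
          rw [mul_assoc, mul_assoc, e1, mul_one]
      _ = T * ψ x⁻¹ := by rw [← hx, ← mul_assoc, e2, one_mul]
  unfold genSub at hg hh
  induction hg using Subgroup.closure_induction with
  | one => simp
  | mul x y _ _ hx hy => rw [map_mul, mul_assoc, hy, ← mul_assoc, hx, mul_assoc]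
  | inv x _ hx => exact hinv x _ hx
  | mem x hx =>
    induction hh using Subgroup.closure_induction with
    | one => simp
    | mul y z _ _ hy hz => rw [map_mul, ← mul_assoc, hy, mul_assoc, hz, mul_assoc]
    | inv y _ hy => exact (hinv y _ hy.symm).symm
    | mem y hy => exact hgen x hx y hy

end GLaux

/-- **Wong, Theorem 4(b) for `GL_n`.**  For integers `n, N > 1` with `N < n` there is a
constant `c(n,N) > 0` such that for every prime `l > c(n,N)` and any rings of integers
`𝒪, 𝒪'` of finite extensions `K, K'` of `ℚ_l` (realized as the integral closure of `ℤ_l`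
in the extension), there is no abstract (not assumed continuous) group homomorphism
`φ : GL_n(𝒪') → GL_N(𝒪)` with non-abelian image. -/
theorem no_nonabelian_abstract_hom_GL (n N : ℕ) (hn : 1 < n) (hN : 1 < N) (hNn : N < n) :
    ∃ c : ℕ, 0 < c ∧
      ∀ (l : ℕ) [Fact (Nat.Prime l)], c < l →
      ∀ (K K' : Type) [Field K] [Field K']
        [Algebra ℚ_[l] K] [Algebra ℚ_[l] K']
        [FiniteDimensional ℚ_[l] K] [FiniteDimensional ℚ_[l] K']
        [Algebra ℤ_[l] K] [Algebra ℤ_[l] K']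
        [IsScalarTower ℤ_[l] ℚ_[l] K] [IsScalarTower ℤ_[l] ℚ_[l] K'],
      ¬ ∃ φ : GL (Fin n) ↥(integralClosure ℤ_[l] K') →* GL (Fin N) ↥(integralClosure ℤ_[l] K),
          ∃ g h : GL (Fin n) ↥(integralClosure ℤ_[l] K'), φ g * φ h ≠ φ h * φ g := by
  refine ⟨2, by norm_num, ?_⟩
  intro l hl hl2 K K' _ _ _ _ _ _ _ _ _ _
  rintro ⟨φ, g, h, hgh⟩
  have hloc : IsLocalRing (integralClosure ℤ_[l] K') := isLocal_integralClosure l K'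
  have h2Z : IsUnit (2 : ℤ_[l]) := by
    rw [PadicInt.isUnit_iff]
    have : ‖((2 : ℕ) : ℤ_[l])‖ = 1 := by
      rw [PadicInt.norm_natCast_eq_one_iff]
      exact (Nat.coprime_primes hl.out Nat.prime_two).mpr (by omega)
    simpa using this
  have h2R : IsUnit (2 : integralClosure ℤ_[l] K') := by
    have h := h2Z.map (algebraMap ℤ_[l] (integralClosure ℤ_[l] K'))
    rwa [map_ofNat] at h
  have h2K : (2 : K) ≠ 0 := by
    have h := (h2Z.map (algebraMap ℤ_[l] K)).ne_zero
    rwa [map_ofNat] at h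
  let ι : Matrix (Fin N) (Fin N) (integralClosure ℤ_[l] K) →* Module.End K (Fin N → K) :=
    ((Matrix.toLinAlgEquiv' : Matrix (Fin N) (Fin N) K ≃ₐ[K] _) : _ →* _).comp
      ((integralClosure ℤ_[l] K).val.toRingHom.mapMatrix :
        Matrix (Fin N) (Fin N) (integralClosure ℤ_[l] K) →+*
          Matrix (Fin N) (Fin N) K).toMonoidHom
  have hι : Function.Injective ι := by
    intro x y hxy
    have h1 := (Matrix.toLinAlgEquiv' : Matrix (Fin N) (Fin N) K ≃ₐ[K] _).injective hxy
    ext i j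
    exact congrFun (congrFun h1 i) j
  let ψ : GL (Fin n) (integralClosure ℤ_[l] K') →* Module.End K (Fin N → K) :=
    ι.comp ((Units.coeHom _).comp φ)
  have hsg : ∀ i j, ψ (sg i) = ψ (sg j) := by
    intro i j
    refine involutions_eq h2K n (by simpa using hNn) (fun i => ψ (sg i)) (fun σ => ψ (pm σ))
      ?_ ?_ ?_ ?_ i j
    · intro i v
      rw [← Module.End.mul_apply, ← map_mul, sg_sq, map_one, Module.End.one_apply]
    · intro i j v
      rw [← Module.End.mul_apply, ← map_mul, sg, sg, dg_comm, map_mul, Module.End.mul_apply]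
    · intro σ v hv
      have := congrArg (ψ (pm σ)⁻¹) hv
      rwa [← Module.End.mul_apply, ← map_mul, inv_mul_cancel, map_one, map_zero,
        Module.End.one_apply] at this
    · intro σ i v
      rw [← Module.End.mul_apply, ← map_mul, pm_sg, map_mul, Module.End.mul_apply]
  have hcomm := rep_comm (by omega) h2R ψ hsg g h
  rw [← map_mul, ← map_mul] at hcomm
  apply hgh
  have h3 := hι hcomm
  rw [← map_mul, ← map_mul]
  exact Units.ext h3
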